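/- If F(x_1,…,x_r) = (f_1(x_1,…,x_r), …, f_r(x_r)) is a K-bilipschitz map of (ℝ^n, D), then each component f_i is K^{α_i}-bilipschitz in the variable x_i: (1/K^{α_i})|x_i − x_i'| ≤ |f_i(x_i, x_{i+1},…,x_r) − f_i(x_i', x_{i+1},…,x_r)| ≤ K^{α_i}|x_i − x_i'|. -/

import Mathlib

open Filter Topology Asymptotics

section Homogeneous

variable {ι : Type*} [Fintype ι] {E : ι → Type*} [∀ i, NormedAddCommGroup (E i)] {α : ι → ℝ}

/-- Each coordinate is bounded by the parabolic distance. -/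
lemma rpow_norm_sub_le_iSup (x y : ∀ i, E i) (i : ι) :
    ‖x i - y i‖ ^ (1 / α i) ≤ ⨆ j, ‖x j - y j‖ ^ (1 / α j) :=
  le_ciSup (f := fun j => ‖x j - y j‖ ^ (1 / α j)) (Set.finite_range _).bddAbove i

/-- The parabolic distance of points differing in a single coordinate. -/
lemma iSup_rpow_norm_sub_eq (hα : ∀ i, 0 < α i) {x y : ∀ i, E i} {i : ι}
    (h : ∀ j, j ≠ i → x j = y j) :
    ⨆ j, ‖x j - y j‖ ^ (1 / α j) = ‖x i - y i‖ ^ (1 / α i) := by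
  have : Nonempty ι := ⟨i⟩
  refine le_antisymm (ciSup_le fun j => ?_) (rpow_norm_sub_le_iSup x y i)
  by_cases hj : j = i
  · subst hj; exact le_rfl
  · have : (1 / α j) ≠ 0 := (one_div_pos.2 (hα j)).ne'
    rw [h j hj, sub_self, norm_zero, Real.zero_rpow this]
    positivity

lemma le_rpow_mul_of_rpow_one_div_le {a b c K : ℝ} (ha : 0 ≤ a) (hb : 0 ≤ b) (hK : 0 ≤ K)
    (hc : 0 < c) (h : a ^ (1 / c) ≤ K * b ^ (1 / c)) : a ≤ K ^ c * b := by
  have h1 := Real.rpow_le_rpow (by positivity) h hc.le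
  rwa [Real.mul_rpow hK (by positivity), ← Real.rpow_mul ha, ← Real.rpow_mul hb,
    one_div_mul_cancel hc.ne', Real.rpow_one, Real.rpow_one] at h1

/-- A function of `t` of the form `(c * |t - s|) ^ p` with `1 < p` is `o(t - s)` at `s`. -/
lemma isLittleO_mul_abs_sub_rpow {c p : ℝ} (hc : 0 ≤ c) (hp : 1 < p) (s : ℝ) :
    (fun t : ℝ => (c * |t - s|) ^ p) =o[𝓝 s] fun t => t - s := by
  have hlim : Tendsto (fun t : ℝ => c ^ p * |t - s| ^ (p - 1)) (𝓝 s) (𝓝 0) := by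
    have hcont : Continuous fun t : ℝ => c ^ p * |t - s| ^ (p - 1) :=
      continuous_const.mul ((by fun_prop : Continuous fun t : ℝ => |t - s|).rpow_const
        fun _ => Or.inr (by linarith))
    simpa [Real.zero_rpow (sub_pos.2 hp).ne'] using hcont.tendsto s
  have hlittle := ((isLittleO_one_iff ℝ).2 hlim).mul_isBigO
    ((isBigO_refl (fun t : ℝ => t - s) (𝓝 s)).abs_left)
  refine hlittle.congr (fun t => ?_) fun t => one_mul _
  rw [Real.mul_rpow hc (abs_nonneg _), mul_assoc]
  congr 1
  rcases (abs_nonneg (t - s)).eq_or_lt with h0 | h0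
  · rw [← h0, mul_zero, Real.zero_rpow (by linarith)]
  · rw [← Real.rpow_add_one h0.ne', sub_add_cancel]

variable [∀ i, NormedSpace ℝ (E i)] [LinearOrder ι]

/-- A map that is Lipschitz for the parabolic distance is triangular: its `i`-th component
depends only on the coordinates `j ≥ i`. -/
lemma eq_of_parabolic_lipschitz (hα : ∀ i, 0 < α i) (hmono : StrictMono α)
    {G : (∀ i, E i) → ∀ i, E i} {K : ℝ} (hK : 0 ≤ K)
    (hG : ∀ p q, ⨆ i, ‖G p i - G q i‖ ^ (1 / α i) ≤ K * ⨆ i, ‖p i - q i‖ ^ (1 / α i))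
    (i : ι) (x y : ∀ i, E i) (h : ∀ j, i ≤ j → x j = y j) : G x i = G y i := by
  have : Nonempty ι := ⟨i⟩
  have hbound (p q : ∀ i, E i) (hpq : ∀ j, i ≤ j → p j = q j) :
      ‖G p i - G q i‖ ≤ K ^ α i * ∑ j with j < i, ‖p j - q j‖ ^ (α i / α j) := by
    obtain ⟨j, hj⟩ := exists_eq_ciSup_of_finite (f := fun j => ‖p j - q j‖ ^ (1 / α j))
    have h1 := (rpow_norm_sub_le_iSup (α := α) (G p) (G q) i).trans (hG p q)
    rw [← hj] at h1
    have h2 : ‖p j - q j‖ ^ (1 / α j) = (‖p j - q j‖ ^ (α i / α j)) ^ (1 / α i) := by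
      rw [← Real.rpow_mul (norm_nonneg _)]
      congr 1
      have := (hα i).ne'
      field_simp
    rw [h2] at h1
    refine (le_rpow_mul_of_rpow_one_div_le (norm_nonneg _) (by positivity) hK (hα i) h1).trans ?_
    refine mul_le_mul_of_nonneg_left ?_ (by positivity)
    by_cases hji : j < i
    · exact Finset.single_le_sum (f := fun j => ‖p j - q j‖ ^ (α i / α j))
        (fun _ _ => by positivity) (by simpa using hji)
    · rw [hpq j (not_lt.1 hji), sub_self, norm_zero,
        Real.zero_rpow (div_pos (hα i) (hα j)).ne']
      exact Finset.sum_nonneg fun _ _ => by positivity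
  set g : ℝ → E i := fun t => G (x + t • (y - x)) i with hg
  have hderiv (s : ℝ) : HasDerivAt g 0 s := by
    rw [hasDerivAt_iff_isLittleO]
    have hsum : (fun t : ℝ => K ^ α i * ∑ j with j < i, (‖y j - x j‖ * |t - s|) ^ (α i / α j))
        =o[𝓝 s] fun t => t - s := by
      refine (IsLittleO.fun_sum fun j hj => ?_).const_mul_left _
      refine isLittleO_mul_abs_sub_rpow (norm_nonneg _) ?_ s
      rw [one_lt_div (hα j)]
      exact hmono (by simpa using hj)
    refine IsBigO.trans_isLittleO (IsBigO.of_bound' (Eventually.of_forall fun t => ?_)) hsum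
    rw [smul_zero, sub_zero]
    refine ((hbound _ _ fun j hj => ?_).trans (le_of_eq ?_)).trans (le_abs_self _)
    · simp [h j hj]
    · congr 1
      refine Finset.sum_congr rfl fun j _ => ?_
      congr 1
      simp only [Pi.add_apply, Pi.smul_apply, Pi.sub_apply]
      rw [add_sub_add_left_eq_sub, ← sub_smul, norm_smul, Real.norm_eq_abs, mul_comm]
  have hconst := is_const_of_deriv_eq_zero (fun s => (hderiv s).differentiableAt)
    (fun s => (hderiv s).deriv) 0 1
  simpa [hg] using hconst

end Homogeneous

/-- Each component `f_i` of a `K`-bilipschitz (lower-triangular) map of `(ℝ^n, D)` is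
`K^{α_i}`-bilipschitz in the variable `x_i`. -/
theorem stmt_6 (r : ℕ) (n : Fin (r + 1) → ℕ) (α : Fin (r + 1) → ℝ)
    (hα : ∀ i, 0 < α i) (hmono : StrictMono α)
    (D : (∀ i, EuclideanSpace ℝ (Fin (n i))) → (∀ i, EuclideanSpace ℝ (Fin (n i))) → ℝ)
    (hD : ∀ x y, D x y = ⨆ i, ‖x i - y i‖ ^ (1 / α i))
    (F : (∀ i, EuclideanSpace ℝ (Fin (n i))) → ∀ i, EuclideanSpace ℝ (Fin (n i)))
    (hFbij : Function.Bijective F) (K : ℝ) (hK : 1 ≤ K)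
    (hbilip : ∀ p q, D p q / K ≤ D (F p) (F q) ∧ D (F p) (F q) ≤ K * D p q)
    (htri : ∀ (i : Fin (r + 1)) (x x' : ∀ i, EuclideanSpace ℝ (Fin (n i))),
      (∀ j, i ≤ j → x j = x' j) → F x i = F x' i) :
    ∀ (i : Fin (r + 1)) (x x' : ∀ i, EuclideanSpace ℝ (Fin (n i))),
      (∀ j, j ≠ i → x j = x' j) →
        ‖x i - x' i‖ / K ^ α i ≤ ‖F x i - F x' i‖ ∧
        ‖F x i - F x' i‖ ≤ K ^ α i * ‖x i - x' i‖ := by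
  intro i x x' hx
  have hK0 : 0 < K := by linarith
  simp only [hD] at hbilip
  constructor
  · let e := Equiv.ofBijective F hFbij
    have he (p) : F (e.symm p) = p := e.apply_symm_apply p
    have hinv (p q) : ⨆ j, ‖e.symm p j - e.symm q j‖ ^ (1 / α j)
        ≤ K * ⨆ j, ‖p j - q j‖ ^ (1 / α j) := by
      have := (hbilip (e.symm p) (e.symm q)).1
      rwa [he, he, div_le_iff₀' hK0] at this
    -- The point `e.symm w` agrees with `x'` in the coordinates `j ≥ i`, and its image
    -- differs from `F x` in the coordinate `i` only.
    let w : ∀ j, EuclideanSpace ℝ (Fin (n j)) := fun j => if j < i then F x j else F x' j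
    have hwi : w i = F x' i := by simp [w]
    have hzi : e.symm w i = x' i := by
      rw [eq_of_parabolic_lipschitz hα hmono hK0.le hinv i w (F x')
        fun j hj => by simp [w, not_lt.2 hj]]
      exact congrFun (e.symm_apply_apply x') i
    have hw (j) (hj : j ≠ i) : F x j = w j := by
      by_cases hji : j < i
      · simp [w, hji]
      · have hij : i < j := lt_of_le_of_ne (not_lt.1 hji) hj.symm
        simp only [w, if_neg hji]
        exact htri j x x' fun k hk => hx k (hij.trans_le hk).ne'
    have h1 := (hbilip x (e.symm w)).1
    rw [he, div_le_iff₀' hK0, iSup_rpow_norm_sub_eq hα hw, hwi] at h1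
    have h2 := (rpow_norm_sub_le_iSup (α := α) x (e.symm w) i).trans h1
    rw [hzi] at h2
    rw [div_le_iff₀' (by positivity)]
    exact le_rpow_mul_of_rpow_one_div_le (norm_nonneg _) (norm_nonneg _) hK0.le (hα i) h2
  · have h1 := (rpow_norm_sub_le_iSup (α := α) (F x) (F x') i).trans (hbilip x x').2
    rw [iSup_rpow_norm_sub_eq hα hx] at h1
    exact le_rpow_mul_of_rpow_one_div_le (norm_nonneg _) (norm_nonneg _) hK0.le (hα i) h1
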